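/- Let n ≥ 4. Among 𝒢_n^0 (connected n-vertex graphs with no cut edges), K_n is the unique last graph and K_n minus one edge is the unique second last graph in the S-order; that is, K_n − e ≺_s K_n, and every G ∈ 𝒢_n^0 isomorphic to neither K_n nor K_n − e satisfies G ≺_s K_n − e. -/

import Mathlib

open SimpleGraph

/-- The `k`-th spectral moment of a graph: the trace of the `k`-th power of its
adjacency matrix. -/
noncomputable def specMoment {V : Type*} [Fintype V] (G : SimpleGraph V) (k : ℕ) : ℝ :=
  letI := Classical.decEq V
  letI : DecidableRel G.Adj := Classical.decRel _
  Matrix.trace ((G.adjMatrix ℝ) ^ k)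

/-- The strict lexicographic order by spectral moments (`S`-order) for graphs on
`n` vertices. -/
def SLt {V W : Type*} [Fintype V] [Fintype W] (n : ℕ)
    (G : SimpleGraph V) (H : SimpleGraph W) : Prop :=
  ∃ k, 1 ≤ k ∧ k ≤ n - 1 ∧ (∀ i, i < k → specMoment G i = specMoment H i) ∧
    specMoment G k < specMoment H k

/-- The number of cut edges (bridges) of a graph. -/
noncomputable def numBridges {V : Type*} (G : SimpleGraph V) : ℕ :=
  {e : Sym2 V | G.IsBridge e}.ncard

/-- `KnMinusEdge n`: the complete graph on `n` vertices with the edge `{0, 1}`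
removed. -/
def KnMinusEdge (n : ℕ) : SimpleGraph (Fin n) :=
  SimpleGraph.fromRel (fun i j =>
    ¬(((i : ℕ) = 0 ∧ (j : ℕ) = 1) ∨ ((i : ℕ) = 1 ∧ (j : ℕ) = 0)))

lemma specMoment_zero' {V : Type*} [Fintype V] (G : SimpleGraph V) :
    specMoment G 0 = Fintype.card V := by
  simp [specMoment]

lemma specMoment_one' {V : Type*} [Fintype V] (G : SimpleGraph V) :
    specMoment G 1 = 0 := by
  simp [specMoment]

open Classical in
lemma specMoment_two' {V : Type*} [Fintype V] (G : SimpleGraph V) :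
    specMoment G 2 = ∑ i : V, ∑ j : V, (if G.Adj i j then (1 : ℝ) else 0) := by
  unfold specMoment
  simp only [pow_two, Matrix.trace, Matrix.diag_apply, Matrix.mul_apply]
  refine Finset.sum_congr rfl fun i _ => Finset.sum_congr rfl fun j _ => ?_
  by_cases h : G.Adj i j <;> simp [SimpleGraph.adjMatrix_apply, G.adj_comm j i, h]

lemma specMoment_two_iso {V : Type*} [Fintype V] (G : SimpleGraph V) (t : V ≃ V) :
    specMoment (G.comap t) 2 = specMoment G 2 := by
  classical
  rw [specMoment_two', specMoment_two']
  rw [← Equiv.sum_comp t (fun i => ∑ j, if G.Adj i j then (1 : ℝ) else 0)]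
  refine Finset.sum_congr rfl fun i _ => ?_
  rw [← Equiv.sum_comp t (fun j => if G.Adj (t i) j then (1 : ℝ) else 0)]
  refine Finset.sum_congr rfl fun j _ => ?_
  simp

lemma specMoment_two_lt {V : Type*} [Fintype V] {G H : SimpleGraph V} (h : G < H) :
    specMoment G 2 < specMoment H 2 := by
  classical
  rw [specMoment_two', specMoment_two']
  have hle : ∀ i j, (if G.Adj i j then (1 : ℝ) else 0) ≤ if H.Adj i j then (1 : ℝ) else 0 := by
    intro i j
    by_cases hg : G.Adj i j
    · simp [hg, h.le hg]
    · simp only [hg, if_false]; split_ifs <;> norm_num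
  have hex : ∃ i j, H.Adj i j ∧ ¬ G.Adj i j := by
    by_contra hc
    push Not at hc
    exact h.not_ge (fun i j hij => hc i j hij)
  obtain ⟨i, j, hH, hG⟩ := hex
  refine Finset.sum_lt_sum (fun i _ => Finset.sum_le_sum fun j _ => hle i j)
    ⟨i, Finset.mem_univ _, Finset.sum_lt_sum (fun j _ => hle i j) ⟨j, Finset.mem_univ _, ?_⟩⟩
  simp [hH, hG]

lemma sLt_of_two {n : ℕ} (hn : 4 ≤ n) {G H : SimpleGraph (Fin n)}
    (h : specMoment G 2 < specMoment H 2) : SLt n G H := by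
  refine ⟨2, by omega, by omega, ?_, h⟩
  intro i hi
  interval_cases i
  · rw [specMoment_zero', specMoment_zero']
  · rw [specMoment_one', specMoment_one']

/-- For `n ≥ 4`, among connected `n`-vertex graphs with no cut edges, `K_n` is
the unique last graph and `K_n` minus one edge is the unique second last graph
in the `S`-order. -/
theorem last_two_no_cut_edges (n : ℕ) (hn : 4 ≤ n) :
    SLt n (KnMinusEdge n) (⊤ : SimpleGraph (Fin n)) ∧
    (∀ G : SimpleGraph (Fin n), G.Connected → numBridges G = 0 →
      ¬ Nonempty (G ≃g (⊤ : SimpleGraph (Fin n))) →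
      SLt n G (⊤ : SimpleGraph (Fin n))) ∧
    (∀ G : SimpleGraph (Fin n), G.Connected → numBridges G = 0 →
      ¬ Nonempty (G ≃g (⊤ : SimpleGraph (Fin n))) →
      ¬ Nonempty (G ≃g KnMinusEdge n) →
      SLt n G (KnMinusEdge n)) := by
  have hne : ∀ G : SimpleGraph (Fin n), ¬ Nonempty (G ≃g (⊤ : SimpleGraph (Fin n))) → G ≠ ⊤ := by
    rintro G hG rfl
    exact hG ⟨SimpleGraph.Iso.refl⟩
  refine ⟨?_, ?_, ?_⟩
  · refine sLt_of_two hn (specMoment_two_lt (lt_top_iff_ne_top.2 ?_))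
    intro h
    have h1 : (KnMinusEdge n).Adj ⟨0, by omega⟩ ⟨1, by omega⟩ := by
      rw [h]; simp
    simp [KnMinusEdge] at h1
  · intro G _ _ hG
    exact sLt_of_two hn (specMoment_two_lt (lt_top_iff_ne_top.2 (hne G hG)))
  · intro G _ _ hG hG'
    have hex : ∃ a b, a ≠ b ∧ ¬ G.Adj a b := by
      by_contra hc
      push Not at hc
      exact hne G hG (eq_top_iff.2 fun i j hij => hc i j hij)
    obtain ⟨a, b, hab, hnadj⟩ := hex
    obtain ⟨t, ht0, ht1⟩ : ∃ t : Fin n ≃ Fin n,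
        t ⟨0, by omega⟩ = a ∧ t ⟨1, by omega⟩ = b := by
      have hc : Equiv.swap (⟨0, by omega⟩ : Fin n) a ⟨1, by omega⟩ ≠ a := by
        intro h
        have h2 : Equiv.swap (⟨0, by omega⟩ : Fin n) a ⟨1, by omega⟩ =
          Equiv.swap (⟨0, by omega⟩ : Fin n) a ⟨0, by omega⟩ := by
            rw [h, Equiv.swap_apply_left]
        have h3 := (Equiv.swap (⟨0, by omega⟩ : Fin n) a).injective h2
        simp at h3
      refine ⟨(Equiv.swap (⟨0, by omega⟩ : Fin n) a).trans
        (Equiv.swap (Equiv.swap (⟨0, by omega⟩ : Fin n) a ⟨1, by omega⟩) b), ?_, ?_⟩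
      · rw [Equiv.trans_apply, Equiv.swap_apply_left]
        exact Equiv.swap_apply_of_ne_of_ne hc.symm hab
      · rw [Equiv.trans_apply, Equiv.swap_apply_left]
    apply sLt_of_two hn
    rw [← specMoment_two_iso G t]
    apply specMoment_two_lt
    refine lt_of_le_of_ne ?_ ?_
    · intro i j hij
      have hij' : G.Adj (t i) (t j) := hij
      simp only [KnMinusEdge, SimpleGraph.fromRel_adj]
      refine ⟨hij.ne, Or.inl ?_⟩
      rintro (⟨h0, h1⟩ | ⟨h1, h0⟩)
      · have e0 : i = ⟨0, by omega⟩ := Fin.ext h0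
        have e1 : j = ⟨1, by omega⟩ := Fin.ext h1
        rw [e0, e1, ht0, ht1] at hij'
        exact hnadj hij'
      · have e0 : j = ⟨0, by omega⟩ := Fin.ext h0
        have e1 : i = ⟨1, by omega⟩ := Fin.ext h1
        rw [e0, e1, ht0, ht1] at hij'
        exact hnadj hij'.symm
    · intro h
      apply hG'
      rw [← h]
      exact ⟨(SimpleGraph.Iso.comap t G).symm⟩
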